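/- There exists a constant c > 0 such that for every prime power q ≥ 2, every integer ŝ with 2 ≤ ŝ ≤ q, and every integer t ≥ 0, there exists a finite sequence over an alphabet of q^(2^t) symbols, with no two consecutive entries equal, of length at least c · q^(2^t) · ŝ^(t+2), which avoids alternations of length (2t+1)(ŝ−1) + 3. -/

import Mathlib

/-- The alternating sequence `a, b, a, b, ...` of length `k`. -/
def altSeq {α : Type*} (a b : α) : ℕ → List α
  | 0 => []
  | k + 1 => a :: altSeq b a k

/-- `l` avoids alternations of length `k`: it has no (not necessarily contiguous)
subsequence `a, b, a, b, ...` of length `k` with `a ≠ b`. -/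
def AvoidsAlt {α : Type*} (l : List α) (k : ℕ) : Prop :=
  ∀ a b : α, a ≠ b → ¬ (altSeq a b k).Sublist l

/-- `k` bounds the length of every alternation of `a` and `b`, in either order, inside `l`. -/
def AltBound {α : Type*} (l : List α) (a b : α) (k : ℕ) : Prop :=
  ∀ j, (altSeq a b j).Sublist l ∨ (altSeq b a j).Sublist l → j ≤ k

section Alternations

variable {α β ι : Type*}

theorem length_altSeq (a b : α) (k : ℕ) : (altSeq a b k).length = k := by
  induction k generalizing a b with
  | zero => rfl
  | succ k ih => simp [altSeq, ih]

theorem map_altSeq (f : α → β) (a b : α) (k : ℕ) :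
    (altSeq a b k).map f = altSeq (f a) (f b) k := by
  induction k generalizing a b with
  | zero => rfl
  | succ k ih => simp [altSeq, ih]

theorem eq_or_eq_of_mem_altSeq {a b x : α} {k : ℕ} (h : x ∈ altSeq a b k) : x = a ∨ x = b := by
  induction k generalizing a b with
  | zero => simp [altSeq] at h
  | succ k ih =>
    rcases List.mem_cons.1 h with h | h
    · exact Or.inl h
    · exact (ih h).symm

theorem isChain_altSeq {a b : α} (hab : a ≠ b) (k : ℕ) : (altSeq a b k).IsChain (· ≠ ·) := by
  induction k generalizing a b with
  | zero => simp [altSeq]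
  | succ k ih =>
    cases k with
    | zero => simp [altSeq]
    | succ k => exact List.isChain_cons_cons.2 ⟨hab, ih hab.symm⟩

/-- An alternation contained in a concatenation splits into two alternations. -/
theorem altSeq_sublist_append {a b : α} {k : ℕ} {l₁ l₂ : List α}
    (h : (altSeq a b k).Sublist (l₁ ++ l₂)) :
    ∃ k₁ k₂, k = k₁ + k₂ ∧ (altSeq a b k₁).Sublist l₁ ∧
      ((altSeq a b k₂).Sublist l₂ ∨ (altSeq b a k₂).Sublist l₂) := by
  induction l₁ generalizing a b k with
  | nil => exact ⟨0, k, by simp, by simp [altSeq], Or.inl h⟩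
  | cons x l₁ ih =>
    cases k with
    | zero => exact ⟨0, 0, rfl, by simp [altSeq], by simp [altSeq]⟩
    | succ k =>
      cases h with
      | cons _ h =>
        obtain ⟨k₁, k₂, hk, h₁, h₂⟩ := ih h
        exact ⟨k₁, k₂, hk, h₁.cons x, h₂⟩
      | cons_cons _ h =>
        obtain ⟨k₁, k₂, hk, h₁, h₂⟩ := ih h
        exact ⟨k₁ + 1, k₂, by omega, h₁.cons_cons _, h₂.symm⟩

theorem AltBound.symm {l : List α} {a b : α} {k : ℕ} (h : AltBound l a b k) :
    AltBound l b a k := fun j hj => h j hj.symm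

theorem AltBound.mono {l : List α} {a b : α} {k k' : ℕ} (h : AltBound l a b k) (hk : k ≤ k') :
    AltBound l a b k' := fun j hj => (h j hj).trans hk

theorem AltBound.sublist {l l' : List α} {a b : α} {k : ℕ} (h : AltBound l a b k)
    (hl : l'.Sublist l) : AltBound l' a b k :=
  fun j hj => h j (hj.imp (·.trans hl) (·.trans hl))

theorem AltBound.append {l₁ l₂ : List α} {a b : α} {k₁ k₂ : ℕ} (h₁ : AltBound l₁ a b k₁)
    (h₂ : AltBound l₂ a b k₂) : AltBound (l₁ ++ l₂) a b (k₁ + k₂) := by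
  rintro j (hj | hj)
  · obtain ⟨j₁, j₂, rfl, hj₁, hj₂⟩ := altSeq_sublist_append hj
    exact add_le_add (h₁ _ (Or.inl hj₁)) (h₂ _ hj₂)
  · obtain ⟨j₁, j₂, rfl, hj₁, hj₂⟩ := altSeq_sublist_append hj
    exact add_le_add (h₁ _ (Or.inr hj₁)) (h₂ _ hj₂.symm)

theorem AltBound.flatMap {L : List ι} {B : ι → List α} {a b : α} {f : ι → ℕ}
    (h : ∀ i ∈ L, AltBound (B i) a b (f i)) : AltBound (L.flatMap B) a b (L.map f).sum := by
  induction L with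
  | nil =>
    intro j hj
    rcases hj with hj | hj <;> simpa [length_altSeq] using hj.length_le
  | cons i L ih =>
    rw [List.flatMap_cons, List.map_cons, List.sum_cons]
    exact (h i (by simp)).append (ih fun i' hi' => h i' (by simp [hi']))

theorem altBound_length (l : List α) (a b : α) : AltBound l a b l.length := by
  rintro j (hj | hj) <;> simpa [length_altSeq] using hj.length_le

/-- If `a` does not occur, alternations have length at most one, and at most zero if `b` does
not occur either. -/
theorem altBound_of_notMem [DecidableEq α] {l : List α} {a b : α} (ha : a ∉ l) :
    AltBound l a b (if b ∈ l then 1 else 0) := by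
  rintro (_ | _ | j) hj
  · simp
  · have hb : b ∈ l := by
      rcases hj with hj | hj
      · exact absurd (hj.subset (by simp [altSeq])) ha
      · exact hj.subset (by simp [altSeq])
    simp [hb]
  · rcases hj with hj | hj <;> exact absurd (hj.subset (by simp [altSeq])) ha

theorem altBound_of_nodup {l : List α} (hl : l.Nodup) (a b : α) : AltBound l a b 2 := by
  intro j hj
  by_contra! h
  obtain ⟨k, rfl⟩ := Nat.exists_eq_add_of_le' h
  rcases hj with hj | hj <;> simpa [altSeq] using hl.sublist hj

theorem AltBound.of_map_leftInverse {l : List α} {g : α → β} {f : β → α}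
    (hfg : Function.LeftInverse f g) {a b : β} {k : ℕ} (h : AltBound l (f a) (f b) k) :
    AltBound (l.map g) a b k := by
  have key : (l.map g).map f = l := by simp [hfg.comp_eq_id]
  rintro j (hj | hj)
  · exact h j (Or.inl (by simpa only [map_altSeq, key] using hj.map f))
  · exact h j (Or.inr (by simpa only [map_altSeq, key] using hj.map f))

/-- Two lists without immediate repetitions can be concatenated at the cost of dropping at most
one entry. -/
theorem exists_isChain_sublist_append {l₁ l₂ : List α} (h₁ : l₁.IsChain (· ≠ ·))
    (h₂ : l₂.IsChain (· ≠ ·)) :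
    ∃ l : List α, l.Sublist (l₁ ++ l₂) ∧ l.IsChain (· ≠ ·) ∧
      l₁.length + l₂.length ≤ l.length + 1 := by
  by_cases h : ∀ x ∈ l₁.getLast?, ∀ y ∈ l₂.head?, x ≠ y
  · exact ⟨l₁ ++ l₂, List.Sublist.refl _, List.isChain_append.2 ⟨h₁, h₂, h⟩, by simp⟩
  · push Not at h
    obtain ⟨x, hx, y, hy, rfl⟩ := h
    cases l₂ with
    | nil => simp at hy
    | cons z l₂ =>
      obtain rfl : z = x := by simpa using hy
      refine ⟨l₁ ++ l₂, (List.sublist_cons_self _ _).append_left _,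
        List.isChain_append.2 ⟨h₁, h₂.tail, ?_⟩, by simp; omega⟩
      intro x' hx' y' hy'
      obtain rfl : z = x' := Option.mem_unique hx hx'
      exact (List.isChain_cons.1 h₂).1 y' hy'

theorem exists_isChain_sublist_flatMap {L : List ι} (hL : L ≠ []) {B : ι → List α} {X : ℝ}
    (hB : ∀ i ∈ L, (B i).IsChain (· ≠ ·)) (hX : ∀ i ∈ L, X + 1 ≤ (B i).length) :
    ∃ l : List α, l.Sublist (L.flatMap B) ∧ l.IsChain (· ≠ ·) ∧
      L.length * X + 1 ≤ l.length := by
  induction L with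
  | nil => exact absurd rfl hL
  | cons i L ih =>
    rcases eq_or_ne L [] with rfl | hL'
    · exact ⟨B i, by simp, hB i (by simp), by simpa using hX i (by simp)⟩
    · obtain ⟨l, hl, hc, hlen⟩ := ih hL' (fun j hj => hB j (by simp [hj]))
        (fun j hj => hX j (by simp [hj]))
      obtain ⟨l', hl', hc', hlen'⟩ := exists_isChain_sublist_append (hB i (by simp)) hc
      refine ⟨l', hl'.trans (by simpa using hl), hc', ?_⟩
      have hi := hX i (by simp)
      have : ((B i).length + l.length : ℝ) ≤ l'.length + 1 := mod_cast hlen'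
      push_cast [List.length_cons]
      linarith

/-- Gluing blocks such that every symbol lies in at most `D` blocks and every pair of symbols
in at most `m` blocks. -/
theorem exists_glue {s : Finset ι} (hs : s.Nonempty) {B : ι → List α} {X : ℝ}
    {K D m : ℕ} (hB : ∀ i ∈ s, (B i).IsChain (· ≠ ·)) (hX : ∀ i ∈ s, X + 1 ≤ (B i).length)
    (hK : ∀ i ∈ s, ∀ a ∈ B i, ∀ b ∈ B i, a ≠ b → AltBound (B i) a b (K + 2))
    (hD : ∀ a, ∀ u ⊆ s, (∀ i ∈ u, a ∈ B i) → u.card ≤ D)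
    (hm : ∀ a b, a ≠ b → ∀ u ⊆ s, (∀ i ∈ u, a ∈ B i ∧ b ∈ B i) → u.card ≤ m) :
    ∃ l : List α, l.IsChain (· ≠ ·) ∧ s.card * X + 1 ≤ l.length ∧
      ∀ a b, a ≠ b → AltBound l a b (K * m + 2 * D) := by
  classical
  obtain ⟨l, hl, hc, hlen⟩ := exists_isChain_sublist_flatMap (L := s.toList) (B := B) (X := X)
    (by simpa using hs.ne_empty) (by simpa using hB) (by simpa using hX)
  refine ⟨l, hc, by simpa using hlen, fun a b hab => AltBound.sublist ?_ hl⟩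
  have hf : ∀ i ∈ s.toList, AltBound (B i) a b (K * (if a ∈ B i ∧ b ∈ B i then 1 else 0) +
      (if a ∈ B i then 1 else 0) + (if b ∈ B i then 1 else 0)) := by
    intro i hi
    by_cases ha : a ∈ B i
    · by_cases hb : b ∈ B i
      · simpa [ha, hb] using hK i (by simpa using hi) a ha b hb hab
      · simpa [ha, hb] using (altBound_of_notMem (b := a) hb).symm
    · simpa [ha] using altBound_of_notMem (b := b) ha
  refine (AltBound.flatMap hf).mono ?_
  rw [Finset.sum_map_toList, Finset.sum_add_distrib, Finset.sum_add_distrib, ← Finset.mul_sum,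
    ← Finset.card_filter, ← Finset.card_filter, ← Finset.card_filter]
  have := Nat.mul_le_mul_left K (hm a b hab _ (Finset.filter_subset _ _)
    fun i hi => (Finset.mem_filter.1 hi).2)
  have := hD a _ (Finset.filter_subset _ _) fun i hi => (Finset.mem_filter.1 hi).2
  have := hD b _ (Finset.filter_subset _ _) fun i hi => (Finset.mem_filter.1 hi).2
  omega

end Alternations

/-- Blocks `i, i + d, i, i + d, ...` for all `i` and for `d` in a fixed set of differences. -/
theorem exists_of_differences {G : Type*} [AddCommGroup G] [Fintype G] [DecidableEq G]
    {e : ℕ} (he : 0 < e) (heG : e < Fintype.card G) :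
    ∃ l : List G, l.IsChain (· ≠ ·) ∧
      (Fintype.card G * e : ℝ) * (2 * e + 1) + 1 ≤ l.length ∧
      ∀ a b, a ≠ b → AltBound l a b (8 * e) := by
  obtain ⟨T, hT, hTe⟩ := Finset.exists_subset_card_eq (s := Finset.univ.erase (0 : G)) (n := e)
    (by rw [Finset.card_erase_of_mem (Finset.mem_univ _), Finset.card_univ]; omega)
  have hT0 : ∀ d ∈ T, d ≠ 0 := fun d hd => Finset.ne_of_mem_erase (hT hd)
  have hmem : ∀ {a : G} {i : G × G}, a ∈ altSeq i.1 (i.1 + i.2) (2 * e + 2) →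
      i.1 = a ∨ i.1 = a - i.2 := by
    intro a i h
    rcases eq_or_eq_of_mem_altSeq h with h | h
    · exact Or.inl h.symm
    · exact Or.inr (by simp [h])
  have hne : (Finset.univ ×ˢ T : Finset (G × G)).Nonempty :=
    Finset.univ_nonempty.product (Finset.card_pos.1 (by omega))
  refine (exists_glue hne
    (B := fun i : G × G => altSeq i.1 (i.1 + i.2) (2 * e + 2)) (X := 2 * e + 1) (K := 2 * e)
    (D := 2 * e) (m := 2) ?_ ?_ ?_ ?_ ?_).imp fun l ⟨hc, hlen, hl⟩ =>
      ⟨hc, by simpa [hTe] using hlen, fun a b hab => (hl a b hab).mono (by omega)⟩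
  · intro i hi
    exact isChain_altSeq (by simpa using hT0 _ (Finset.mem_product.1 hi).2) _
  · intro i _
    rw [length_altSeq]
    push_cast
    linarith
  · intro i _ a _ b _ _
    simpa only [length_altSeq] using altBound_length (altSeq i.1 (i.1 + i.2) (2 * e + 2)) a b
  · intro a u hu ha
    calc _ ≤ ((T.image fun d => (a, d)) ∪ T.image fun d => (a - d, d)).card := by
          refine Finset.card_le_card fun i hi => ?_
          have h := ha i hi
          have hd := (Finset.mem_product.1 (hu hi)).2
          rcases hmem h with h | h
          · exact Finset.mem_union_left _ (Finset.mem_image.2 ⟨i.2, hd, by simp [← h]⟩)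
          · exact Finset.mem_union_right _ (Finset.mem_image.2 ⟨i.2, hd, by simp [← h]⟩)
      _ ≤ T.card + T.card :=
          (Finset.card_union_le _ _).trans (add_le_add Finset.card_image_le Finset.card_image_le)
      _ = 2 * e := by omega
  · intro a b hab u _ hu
    calc _ ≤ ({(a, b - a), (b, a - b)} : Finset (G × G)).card := by
          refine Finset.card_le_card fun i hi => ?_
          obtain ⟨ha, hb⟩ := hu i hi
          obtain ⟨x, d⟩ := i
          rcases eq_or_eq_of_mem_altSeq ha with rfl | rfl <;>
            rcases eq_or_eq_of_mem_altSeq hb with rfl | rfl <;> simp_all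
      _ ≤ 2 := Finset.card_le_two

theorem exists_of_card_eq {α : Type*} [Fintype α] {s : ℕ} (hα : IsPrimePow (Fintype.card α))
    (hs : 2 ≤ s) (hsα : s ≤ Fintype.card α) :
    ∃ l : List α, l.IsChain (· ≠ ·) ∧
      (1 / 100 : ℝ) * Fintype.card α * (s : ℝ) ^ 2 + 1 ≤ l.length ∧
      ∀ a b, a ≠ b → AltBound l a b (s + 1) := by
  classical
  have hn : (2 : ℝ) ≤ Fintype.card α := mod_cast hs.trans hsα
  rcases le_or_gt s 6 with h6 | h6
  · refine ⟨Finset.univ.toList, (Finset.nodup_toList _).isChain, ?_, fun a b _ =>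
      (altBound_of_nodup (Finset.nodup_toList _) a b).mono (by omega)⟩
    have h6' : (s : ℝ) ≤ 6 := mod_cast h6
    have hsq : (s : ℝ) ^ 2 ≤ 36 := by nlinarith [(Nat.cast_nonneg s : (0 : ℝ) ≤ s)]
    rw [Finset.length_toList, Finset.card_univ]
    nlinarith
  · obtain ⟨_⟩ := Fintype.nonempty_field_iff.2 hα
    obtain ⟨l, hc, hlen, hl⟩ := exists_of_differences (G := α) (e := (s + 1) / 8) (by omega)
      (by omega)
    refine ⟨l, hc, le_trans ?_ hlen, fun a b hab => (hl a b hab).mono (by omega)⟩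
    generalize he : (s + 1) / 8 = e
    have hse : (s : ℝ) ≤ 14 * e := mod_cast (by omega : s ≤ 14 * e)
    have hsq : (s : ℝ) ^ 2 ≤ 196 * e ^ 2 := by
      nlinarith [(Nat.cast_nonneg s : (0 : ℝ) ≤ s)]
    have he0 : (0 : ℝ) ≤ e := Nat.cast_nonneg e
    have : (1 / 100 : ℝ) * s ^ 2 ≤ e * (2 * e + 1) := by nlinarith
    nlinarith

/-- Copies of one sequence placed along the lines of `s` parallel classes of an affine plane. -/
theorem exists_of_lines {F : Type*} [Field F] [Fintype F] [DecidableEq F] {s K : ℕ} {X : ℝ}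
    (hs : 0 < s) (hsF : s ≤ Fintype.card F) {l₀ : List F} (hc₀ : l₀.IsChain (· ≠ ·))
    (hX : X + 1 ≤ l₀.length) (hK : ∀ a b, a ≠ b → AltBound l₀ a b (K + 2)) :
    ∃ l : List (F × F), l.IsChain (· ≠ ·) ∧ (s * Fintype.card F : ℝ) * X + 1 ≤ l.length ∧
      ∀ a b, a ≠ b → AltBound l a b (K + 2 * s) := by
  obtain ⟨S, -, hS⟩ := Finset.exists_subset_card_eq (s := (Finset.univ : Finset F)) (n := s)
    (by simpa using hsF)
  let line : F × F → F → F × F := fun i x => (x, i.1 * x + i.2)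
  have hinv : ∀ i, Function.LeftInverse Prod.fst (line i) := fun i x => rfl
  have hmem : ∀ {p i : F × F}, p ∈ l₀.map (line i) → p.2 = i.1 * p.1 + i.2 := by
    intro p i h
    obtain ⟨x, -, rfl⟩ := List.mem_map.1 h
    rfl
  have hne : (S ×ˢ Finset.univ : Finset (F × F)).Nonempty :=
    (Finset.card_pos.1 (by omega)).product Finset.univ_nonempty
  refine (exists_glue hne (B := fun i => l₀.map (line i)) (X := X) (K := K)
    (D := s) (m := 1) ?_ ?_ ?_ ?_ ?_).imp fun l ⟨hc, hlen, hl⟩ =>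
      ⟨hc, by simpa [hS] using hlen, fun a b hab => by simpa using hl a b hab⟩
  · intro i _
    exact List.isChain_map_of_isChain _ (fun x y h => (hinv i).injective.ne h) hc₀
  · simpa using fun _ _ => hX
  · intro i _ a ha b hb hab
    refine AltBound.of_map_leftInverse (hinv i) (hK _ _ fun h => hab (Prod.ext h ?_))
    rw [hmem ha, hmem hb, h]
  · intro a u hu ha
    calc _ ≤ (S.image fun m => (m, a.2 - m * a.1)).card := by
          refine Finset.card_le_card fun i hi => ?_
          have h := ha i hi
          exact Finset.mem_image.2 ⟨i.1, (Finset.mem_product.1 (hu hi)).1,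
            Prod.ext rfl (by simp [hmem h])⟩
      _ ≤ s := hS ▸ Finset.card_image_le
  · intro a b hab u _ hu
    refine Finset.card_le_one.2 fun i hi j hj => ?_
    obtain ⟨hia, hib⟩ := hu i hi
    obtain ⟨hja, hjb⟩ := hu j hj
    replace hia := hmem hia
    replace hib := hmem hib
    replace hja := hmem hja
    replace hjb := hmem hjb
    have hx : a.1 - b.1 ≠ 0 := fun h => hab (Prod.ext (sub_eq_zero.1 h) (by
      rw [hia, hib, sub_eq_zero.1 h]))
    have h1 : i.1 = j.1 := mul_right_cancel₀ hx (by linear_combination hja - hia - hjb + hib)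
    exact Prod.ext h1 (by linear_combination hja - hia - a.1 * h1)

theorem exists_of_card_eq_pow {q s : ℕ} (hq : IsPrimePow q) (hs : 2 ≤ s) (hsq : s ≤ q) (t : ℕ) :
    ∀ {α : Type} [Fintype α], Fintype.card α = q ^ 2 ^ t →
      ∃ l : List α, l.IsChain (· ≠ ·) ∧
        (1 / 100 : ℝ) * (q : ℝ) ^ 2 ^ t * (s : ℝ) ^ (t + 2) + 1 ≤ l.length ∧
        ∀ a b, a ≠ b → AltBound l a b ((2 * t + 1) * (s - 1) + 2) := by
  induction t with
  | zero =>
    intro α _ hα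
    rw [pow_zero, pow_one] at hα
    obtain ⟨l, hc, hlen, hl⟩ := exists_of_card_eq (hα.symm ▸ hq) hs (hα.symm ▸ hsq)
    exact ⟨l, hc, by simpa [hα] using hlen, fun a b hab => (hl a b hab).mono (by omega)⟩
  | succ t ih =>
    intro α _ hα
    have hpow : q ≤ q ^ 2 ^ t := Nat.le_self_pow (by positivity) q
    obtain ⟨_⟩ := Fintype.nonempty_field_iff (α := Fin (q ^ 2 ^ t)).2
      (by simpa using hq.pow (by positivity))
    obtain ⟨l₀, hc₀, hlen₀, hl₀⟩ := ih (Fintype.card_fin (q ^ 2 ^ t))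
    obtain ⟨l, hc, hlen, hl⟩ := exists_of_lines (s := s) (by omega)
      (by simpa using hsq.trans hpow) hc₀ hlen₀ hl₀
    have e : Fin (q ^ 2 ^ t) × Fin (q ^ 2 ^ t) ≃ α := Fintype.equivOfCardEq (by
      rw [Fintype.card_prod, Fintype.card_fin, hα, pow_succ 2 t, pow_mul, sq])
    refine ⟨l.map e, List.isChain_map_of_isChain _ (fun x y h => e.injective.ne h) hc, ?_, ?_⟩
    · rw [List.length_map]
      refine le_trans (le_of_eq ?_) hlen
      rw [Fintype.card_fin]
      push_cast
      ring
    · intro a b hab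
      refine AltBound.of_map_leftInverse e.left_inv
        ((hl _ _ (e.symm.injective.ne hab)).mono ?_)
      obtain ⟨r, rfl⟩ := Nat.exists_eq_add_of_le' hs
      rw [show r + 2 - 1 = r + 1 from rfl]
      apply le_of_eq
      ring

theorem stmt11 :
    ∃ c : ℝ, 0 < c ∧ ∀ q sh t : ℕ, IsPrimePow q → 2 ≤ q → 2 ≤ sh → sh ≤ q →
      ∃ l : List (Fin (q ^ 2 ^ t)), l.Chain' (· ≠ ·) ∧
        c * (q : ℝ) ^ (2 ^ t) * (sh : ℝ) ^ (t + 2) ≤ (l.length : ℝ) ∧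
        AvoidsAlt l ((2 * t + 1) * (sh - 1) + 3) := by
  refine ⟨1 / 100, by norm_num, fun q sh t hq _ hs hsq => ?_⟩
  obtain ⟨l, hc, hlen, hl⟩ := exists_of_card_eq_pow hq hs hsq t (Fintype.card_fin _)
  refine ⟨l, hc, by linarith, fun a b hab h => ?_⟩
  have := hl a b hab _ (Or.inl h)
  omega
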